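/- Assume (f_n) is a sequence of monotone non-expansive functions f_n : X → X converging pointwise to a function f : X → X which has at least one fixpoint, let ((α_n),(β_n)) be an exact Mann scheme, let x_0 ∈ X, and let (x_n) be the dampened Mann iteration with function sequence (f_n). If the sequence (f_n) is monotone in n (either f_n ≤ f_{n+1} pointwise for all n, or f_n ≥ f_{n+1} pointwise for all n), each f_n has a least fixpoint μf_n, and lim_{n→∞} μf_n = μf, then (x_n) converges to μf. -/

import Mathlib

open Filter Set Topology

/-- The dampened Mann iteration:
`x₀ = x0`, `x_{n+1} = (1 - β n) • (α n • x n + (1 - α n) • f n (x n))`. -/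
noncomputable def mannSeq {E : Type*} [AddCommGroup E] [Module ℝ E]
    (α β : ℕ → ℝ) (f : ℕ → E → E) (x0 : E) : ℕ → E
  | 0 => x0
  | n + 1 => (1 - β n) • (α n • mannSeq α β f x0 n + (1 - α n) • f n (mannSeq α β f x0 n))

/-- An exact Mann scheme: a pair of sequences in `[0,1)` with `β n → 0` and
`Σ β n = ∞` such that, for every dimension `d`, every closed convex set
`X ⊆ ℝ^d` of non-negative vectors containing `0`, every monotone non-expansive
`g : X → X` with at least one fixpoint and every starting point in `X`, the
dampened Mann iteration with the constant function sequence `g` converges to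
the least fixpoint of `g`. -/
def ExactScheme (α β : ℕ → ℝ) : Prop :=
  (∀ n, α n ∈ Set.Ico (0 : ℝ) 1) ∧ (∀ n, β n ∈ Set.Ico (0 : ℝ) 1) ∧
  Tendsto β atTop (nhds 0) ∧ ¬ Summable β ∧
  ∀ (d : ℕ) (X : Set (Fin d → ℝ)), IsClosed X → Convex ℝ X →
    (∀ x ∈ X, ∀ i, 0 ≤ x i) → (0 : Fin d → ℝ) ∈ X →
    ∀ g : (Fin d → ℝ) → (Fin d → ℝ), Set.MapsTo g X X →
      (∀ x ∈ X, ∀ y ∈ X, x ≤ y → g x ≤ g y) → LipschitzOnWith 1 g X →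
      (∃ x ∈ X, g x = x) →
      ∀ μ, IsLeast {x | x ∈ X ∧ g x = x} μ →
        ∀ x0 ∈ X, Tendsto (mannSeq α β (fun _ => g) x0) atTop (nhds μ)

theorem mannSeq_mem {E : Type*} [AddCommGroup E] [Module ℝ E] {α β : ℕ → ℝ}
    (hα : ∀ n, α n ∈ Set.Ico (0 : ℝ) 1) (hβ : ∀ n, β n ∈ Set.Ico (0 : ℝ) 1)
    {X : Set E} (hXc : Convex ℝ X) (h0 : (0 : E) ∈ X) {f : ℕ → E → E}
    (hf : ∀ n, Set.MapsTo (f n) X X) {x0 : E} (hx0 : x0 ∈ X) (n : ℕ) :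
    mannSeq α β f x0 n ∈ X := by
  induction n with
  | zero => exact hx0
  | succ n ih =>
    have h1 := hXc ih (hf n ih) (hα n).1 (sub_nonneg.2 (hα n).2.le) (by ring)
    have h2 := hXc h1 h0 (sub_nonneg.2 (hβ n).2.le) (hβ n).1 (by ring)
    simpa [mannSeq] using h2

theorem mannSeq_le_mannSeq {ι : Type*} {α β : ℕ → ℝ}
    (hα : ∀ n, α n ∈ Set.Ico (0 : ℝ) 1) (hβ : ∀ n, β n ∈ Set.Ico (0 : ℝ) 1)
    {X : Set (ι → ℝ)} (hXc : Convex ℝ X) (h0 : (0 : ι → ℝ) ∈ X)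
    {f g : ℕ → (ι → ℝ) → (ι → ℝ)}
    (hf : ∀ n, Set.MapsTo (f n) X X) (hg : ∀ n, Set.MapsTo (g n) X X)
    (hgmono : ∀ n, ∀ x ∈ X, ∀ y ∈ X, x ≤ y → g n x ≤ g n y)
    (hfg : ∀ n, ∀ x ∈ X, f n x ≤ g n x) {x0 : ι → ℝ} (hx0 : x0 ∈ X) (n : ℕ) :
    mannSeq α β f x0 n ≤ mannSeq α β g x0 n := by
  induction n with
  | zero => exact le_rfl
  | succ n ih =>
    have hx := mannSeq_mem hα hβ hXc h0 hf hx0 n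
    have hy := mannSeq_mem hα hβ hXc h0 hg hx0 n
    have h1 := (hfg n _ hx).trans (hgmono n _ hx _ hy ih)
    have h2 := sub_nonneg.2 (hβ n).2.le
    have h3 := sub_nonneg.2 (hα n).2.le
    have h4 := (hα n).1
    simp only [mannSeq]
    exact smul_le_smul_of_nonneg_left
      (add_le_add (smul_le_smul_of_nonneg_left ih h4) (smul_le_smul_of_nonneg_left h1 h3)) h2

/-- Two dampened Mann iterations whose functions eventually agree are asymptotically equal,
since the damping contracts their difference by `∏ (1 - β n) = 0`. -/
theorem tendsto_mannSeq_sub_mannSeq {E : Type*} [NormedAddCommGroup E] [NormedSpace ℝ E]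
    {α β : ℕ → ℝ} (hα : ∀ n, α n ∈ Set.Ico (0 : ℝ) 1) (hβ : ∀ n, β n ∈ Set.Ico (0 : ℝ) 1)
    (hsum : ¬ Summable β) {X : Set E} (hXc : Convex ℝ X) (h0 : (0 : E) ∈ X)
    {f g : ℕ → E → E} (hf : ∀ n, Set.MapsTo (f n) X X) (hg : ∀ n, Set.MapsTo (g n) X X)
    (hgne : ∀ n, LipschitzOnWith 1 (g n) X) {k : ℕ} (hfg : ∀ n, k ≤ n → f n = g n)
    {x0 : E} (hx0 : x0 ∈ X) :
    Tendsto (fun n => mannSeq α β f x0 n - mannSeq α β g x0 n) atTop (𝓝 0) := by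
  set x := mannSeq α β f x0 with hxdef
  set y := mannSeq α β g x0 with hydef
  have hstep : ∀ n, k ≤ n → ‖x (n + 1) - y (n + 1)‖ ≤ (1 - β n) * ‖x n - y n‖ := by
    intro n hn
    have hx := mannSeq_mem hα hβ hXc h0 hf hx0 n
    have hy := mannSeq_mem hα hβ hXc h0 hg hx0 n
    have hb := sub_nonneg.2 (hβ n).2.le
    have ha := sub_nonneg.2 (hα n).2.le
    have hlip : ‖g n (x n) - g n (y n)‖ ≤ ‖x n - y n‖ := by
      simpa using (hgne n).norm_sub_le hx hy
    have heq : x (n + 1) - y (n + 1) =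
        (1 - β n) • (α n • (x n - y n) + (1 - α n) • (g n (x n) - g n (y n))) := by
      rw [hxdef, hydef]
      simp only [mannSeq, hfg n hn]
      module
    rw [heq, norm_smul, Real.norm_of_nonneg hb]
    refine mul_le_mul_of_nonneg_left ((norm_add_le _ _).trans ?_) hb
    rw [norm_smul, norm_smul, Real.norm_of_nonneg ha, Real.norm_of_nonneg (hα n).1]
    nlinarith
  have hbound : ∀ n, k ≤ n → ‖x n - y n‖ ≤
      Real.exp (-(∑ i ∈ Finset.range n, β i)) *
        (Real.exp (∑ i ∈ Finset.range k, β i) * ‖x k - y k‖) := by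
    intro n hn
    induction n, hn using Nat.le_induction with
    | base => rw [← mul_assoc, ← Real.exp_add]; simp
    | succ n hn ih =>
      refine (hstep n hn).trans ?_
      rw [Finset.sum_range_succ, neg_add, add_comm, Real.exp_add, mul_assoc]
      exact mul_le_mul (Real.one_sub_le_exp_neg _) ih (norm_nonneg _) (Real.exp_pos _).le
  have hdiv : Tendsto (fun n => ∑ i ∈ Finset.range n, β i) atTop atTop :=
    (not_summable_iff_tendsto_nat_atTop_of_nonneg fun n => (hβ n).1).1 hsum
  have hlim := (Real.tendsto_exp_neg_atTop_nhds_zero.comp hdiv).mul_const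
    (Real.exp (∑ i ∈ Finset.range k, β i) * ‖x k - y k‖)
  rw [zero_mul] at hlim
  exact squeeze_zero_norm' ((eventually_ge_atTop k).mono hbound) hlim

/-- for an exact Mann scheme and a monotone (in `n`) sequence of
monotone non-expansive approximations `fn → f` with `μ fn → μ f`, the dampened
Mann iteration converges to `μ f`. -/
theorem mann_convergence_monotone_approximations
    (α β : ℕ → ℝ) (hexact : ExactScheme α β)
    (d : ℕ) (X : Set (Fin d → ℝ)) (hX : IsClosed X) (hXc : Convex ℝ X)
    (hpos : ∀ x ∈ X, ∀ i, 0 ≤ x i) (h0 : (0 : Fin d → ℝ) ∈ X)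
    (fn : ℕ → (Fin d → ℝ) → (Fin d → ℝ))
    (hfnmap : ∀ n, Set.MapsTo (fn n) X X)
    (hfnmono : ∀ n, ∀ x ∈ X, ∀ y ∈ X, x ≤ y → fn n x ≤ fn n y)
    (hfnne : ∀ n, LipschitzOnWith 1 (fn n) X)
    (f : (Fin d → ℝ) → (Fin d → ℝ)) (hmap : Set.MapsTo f X X)
    (hconv : ∀ x ∈ X, Tendsto (fun n => fn n x) atTop (nhds (f x)))
    (hfix : ∃ x ∈ X, f x = x)
    (hmonon : (∀ n, ∀ x ∈ X, fn n x ≤ fn (n + 1) x) ∨ (∀ n, ∀ x ∈ X, fn (n + 1) x ≤ fn n x))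
    (μ : Fin d → ℝ) (hμ : IsLeast {x | x ∈ X ∧ f x = x} μ)
    (μn : ℕ → Fin d → ℝ) (hμn : ∀ n, IsLeast {x | x ∈ X ∧ fn n x = x} (μn n))
    (hμconv : Tendsto μn atTop (nhds μ))
    (x0 : Fin d → ℝ) (hx0 : x0 ∈ X) :
    Tendsto (mannSeq α β fn x0) atTop (nhds μ) := by
  obtain ⟨hα, hβ, -, hsum, hex⟩ := hexact
  have hfmono : ∀ x ∈ X, ∀ y ∈ X, x ≤ y → f x ≤ f y := fun x hx y hy hxy =>
    le_of_tendsto_of_tendsto' (hconv x hx) (hconv y hy) fun n => hfnmono n x hx y hy hxy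
  have hfne : LipschitzOnWith 1 f X := LipschitzOnWith.of_dist_le_mul fun x hx y hy =>
    le_of_tendsto' ((hconv x hx).dist (hconv y hy)) fun n => (hfnne n).dist_le_mul x hx y hy
  have hflim : Tendsto (mannSeq α β (fun _ => f) x0) atTop (𝓝 μ) :=
    hex d X hX hXc hpos h0 f hmap hfmono hfne hfix μ hμ x0 hx0
  -- freezing the approximation at stage `k` gives an iteration with limit `μn k`
  have hfrozen : ∀ k, Tendsto (mannSeq α β (fun n => fn (min n k)) x0) atTop (𝓝 (μn k)) := by
    intro k
    have h1 := hex d X hX hXc hpos h0 (fn k) (hfnmap k) (hfnmono k) (hfnne k)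
      ⟨μn k, (hμn k).1⟩ (μn k) (hμn k) x0 hx0
    have h2 := tendsto_mannSeq_sub_mannSeq hα hβ hsum hXc h0
      (f := fun n => fn (min n k)) (g := fun _ => fn k) (fun n => hfnmap _)
      (fun _ => hfnmap k) (fun _ => hfnne k) (k := k)
      (fun n hn => by simp only [min_eq_right hn]) hx0
    simpa using h2.add h1
  rw [tendsto_pi_nhds] at hflim hμconv ⊢
  intro i
  refine tendsto_order.2 ⟨fun a ha => ?_, fun a ha => ?_⟩
  · rcases hmonon with hm | hm
    · obtain ⟨k, hk⟩ := ((hμconv i).eventually_const_lt ha).exists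
      filter_upwards [(tendsto_pi_nhds.1 (hfrozen k) i).eventually_const_lt hk] with n hn
      exact hn.trans_le (mannSeq_le_mannSeq hα hβ hXc h0 (fun _ => hfnmap _) hfnmap hfnmono
        (fun n x hx => monotone_nat_of_le_succ (f := fun n => fn n x)
          (fun n => hm n x hx) (min_le_left n k)) hx0 n i)
    · filter_upwards [(hflim i).eventually_const_lt ha] with n hn
      exact hn.trans_le (mannSeq_le_mannSeq hα hβ hXc h0 (fun _ => hmap) hfnmap hfnmono
        (fun n x hx => (antitone_nat_of_succ_le (f := fun n => fn n x)
          (fun n => hm n x hx)).le_of_tendsto (hconv x hx) n) hx0 n i)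
  · rcases hmonon with hm | hm
    · filter_upwards [(hflim i).eventually_lt_const ha] with n hn
      exact (mannSeq_le_mannSeq hα hβ hXc h0 hfnmap (fun _ => hmap) (fun _ => hfmono)
        (fun n x hx => (monotone_nat_of_le_succ (f := fun n => fn n x)
          (fun n => hm n x hx)).ge_of_tendsto (hconv x hx) n) hx0 n i).trans_lt hn
    · obtain ⟨k, hk⟩ := ((hμconv i).eventually_lt_const ha).exists
      filter_upwards [(tendsto_pi_nhds.1 (hfrozen k) i).eventually_lt_const hk] with n hn
      exact (mannSeq_le_mannSeq hα hβ hXc h0 hfnmap (fun _ => hfnmap _) (fun _ => hfnmono _)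
        (fun n x hx => antitone_nat_of_succ_le (f := fun n => fn n x)
          (fun n => hm n x hx) (min_le_left n k)) hx0 n i).trans_lt hn
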